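/- arXiv:2602.12483 — 3 statements merged into one kernel-verified Lean document; each statement's English description precedes it below -/
import Mathlib

section
/- Let A ∈ ℝ^{m×n} have rows a_1, …, a_m with ‖a_i‖₂ = 1, let x⋆ ∈ ℝⁿ, b_i = ⟨a_i, x⋆⟩, b̃ = b + ε, and let r_i(x) = ⟨a_i, x⟩ − b̃_i. Let s ≥ 1 be at most the number of nonzero entries of ε, and let ε_(s) denote the s-th largest value among (|ε_i|)_{i=1}^m, so ε_(s) > 0. If ‖x − x⋆‖₂ < ε_(s)/2, then for every index i with |ε_i| ≥ ε_(s) and every index j with ε_j = 0 one has |r_i(x)| > ε_(s)/2 > |r_j(x)|; that is, all rows whose corruption magnitude is at least ε_(s) have strictly larger residuals than every uncorrupted row. -/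
open RealInnerProductSpace

/-- Unit-norm rows `a i`, clean labels `b i = ⟨a i, x⋆⟩`, observed
labels `b̃ i = b i + ε i`, residuals `r i x = ⟨a i, x⟩ − b̃ i`.  Let `1 ≤ s` be at
most the number of nonzero entries of `ε`, and let `εs` be the s-th largest value
among `(|ε i|)` (characterized by: at least `s` indices have `|ε i| ≥ εs`, fewer
than `s` indices have `|ε i| > εs`, and `εs` is attained).  Then `εs > 0`, and if
`‖x − x⋆‖ < εs/2`, every row `i` with `|ε i| ≥ εs` and every row `j` with
`ε j = 0` satisfy `|r i x| > εs/2 > |r j x|`. -/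
theorem top_corruption_residual_separation {m n : ℕ}
    (a : Fin m → EuclideanSpace ℝ (Fin n)) (ha : ∀ i, ‖a i‖ = 1)
    (xstar x : EuclideanSpace ℝ (Fin n)) (ε : Fin m → ℝ)
    (btilde : Fin m → ℝ) (hb : ∀ i, btilde i = ⟪a i, xstar⟫ + ε i)
    (r : Fin m → ℝ) (hr : ∀ i, r i = ⟪a i, x⟫ - btilde i)
    (s : ℕ) (hs1 : 1 ≤ s)
    (hs2 : s ≤ (Finset.univ.filter fun i => ε i ≠ 0).card)
    (εs : ℝ)
    (hεs_ge : s ≤ (Finset.univ.filter fun i => εs ≤ |ε i|).card)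
    (hεs_gt : (Finset.univ.filter fun i => εs < |ε i|).card < s)
    (hεs_mem : ∃ i, |ε i| = εs)
    (hx : ‖x - xstar‖ < εs / 2) :
    0 < εs ∧
      ∀ i j : Fin m, εs ≤ |ε i| → ε j = 0 → εs / 2 < |r i| ∧ |r j| < εs / 2 := by
  refine ⟨by linarith [norm_nonneg (x - xstar)], fun i j hi hj => ?_⟩
  have residual_eq : ∀ k, r k = ⟪a k, x - xstar⟫ - ε k := fun k => by
    rw [hr, hb, inner_sub_right]; ring
  have inner_lt : ∀ k, |⟪a k, x - xstar⟫| < εs / 2 := fun k =>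
    lt_of_le_of_lt (by simpa [ha k] using abs_real_inner_le_norm (a k) (x - xstar)) hx
  constructor
  · have h := abs_sub_abs_le_abs_sub (ε i) ⟪a i, x - xstar⟫
    rw [residual_eq, abs_sub_comm]
    linarith [inner_lt i]
  · simpa [residual_eq, hj] using inner_lt j
end

section
/- (Claim 1.) Let A ∈ ℝ^{m×n} have rows a_1, …, a_m with ‖a_i‖₂ = 1, let x⋆ ∈ ℝⁿ, b_i = ⟨a_i, x⋆⟩, b̃ = b + ε, and let r_i(x) = ⟨a_i, x⟩ − b̃_i. Let s ≥ 1 satisfy s ≤ ‖ε‖₀ (the number of nonzero entries of ε) and let ε_(s) be the s-th largest value among (|ε_i|)_{i=1}^m. If ‖x − x⋆‖₂ < ε_(s)/2, then every set S ⊆ {1,…,m} of cardinality s with the property that |r_i(x)| ≥ |r_j(x)| for all i ∈ S and all j ∉ S (i.e., S carries the s largest residual magnitudes) consists entirely of corrupted indices: ε_i ≠ 0 for every i ∈ S. -/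
open RealInnerProductSpace

/-- Claim 1: Unit-norm rows `a i`, clean labels `b i = ⟨a i, x⋆⟩`,
observed labels `b̃ i = b i + ε i`, residuals `r i x = ⟨a i, x⟩ − b̃ i`.  Let
`1 ≤ s ≤ ‖ε‖₀` and let `εs` be the s-th largest value among `(|ε i|)`.  If
`‖x − x⋆‖ < εs/2`, then every set `S` of cardinality `s` carrying the `s` largest
residual magnitudes (i.e. `|r j x| ≤ |r i x|` for all `i ∈ S`, `j ∉ S`) consists
entirely of corrupted indices. -/
theorem top_residuals_are_corrupted {m n : ℕ}
    (a : Fin m → EuclideanSpace ℝ (Fin n)) (ha : ∀ i, ‖a i‖ = 1)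
    (xstar x : EuclideanSpace ℝ (Fin n)) (ε : Fin m → ℝ)
    (btilde : Fin m → ℝ) (hb : ∀ i, btilde i = ⟪a i, xstar⟫ + ε i)
    (r : Fin m → ℝ) (hr : ∀ i, r i = ⟪a i, x⟫ - btilde i)
    (s : ℕ) (hs1 : 1 ≤ s)
    (hs2 : s ≤ (Finset.univ.filter fun i => ε i ≠ 0).card)
    (εs : ℝ)
    (hεs_ge : s ≤ (Finset.univ.filter fun i => εs ≤ |ε i|).card)
    (hεs_gt : (Finset.univ.filter fun i => εs < |ε i|).card < s)
    (hεs_mem : ∃ i, |ε i| = εs)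
    (hx : ‖x - xstar‖ < εs / 2) :
    ∀ S : Finset (Fin m), S.card = s →
      (∀ i ∈ S, ∀ j ∉ S, |r j| ≤ |r i|) →
      ∀ i ∈ S, ε i ≠ 0 := by
  intro S hS hmax i hi hεi
  set d := ‖x - xstar‖
  have hd0 : 0 ≤ d := norm_nonneg _
  have hinner : ∀ k, |⟪a k, x - xstar⟫| ≤ d := fun k => by
    simpa [ha k] using abs_real_inner_le_norm (a k) (x - xstar)
  have hres : ∀ k, r k = ⟪a k, x - xstar⟫ - ε k := fun k => by
    rw [hr, hb, inner_sub_right]; ring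
  obtain ⟨j, hjT, hjS⟩ : ∃ j ∈ Finset.univ.filter (fun k => εs ≤ |ε k|), j ∉ S := by
    by_contra! hsub
    have hTS := Finset.eq_of_subset_of_card_le hsub (hS.trans_le hεs_ge)
    rw [← hTS, Finset.mem_filter, hεi, abs_zero] at hi
    linarith [hi.2]
  have hεj : εs ≤ |ε j| := (Finset.mem_filter.mp hjT).2
  have hri : |r i| ≤ d := by simpa [hres i, hεi] using hinner i
  have hrj : |ε j| - d ≤ |r j| := by
    rw [hres j, abs_sub_comm]
    linarith [abs_sub_abs_le_abs_sub (ε j) ⟪a j, x - xstar⟫, hinner j]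
  linarith [hmax i hi j hjS]
end

section
/- (Residual-screening lemma, abstract form.) Let A ∈ ℝ^{m×n} have rows a_1, …, a_m with ‖a_i‖₂ = 1, let x⋆ ∈ ℝⁿ, b_i = ⟨a_i, x⋆⟩, b̃ = b + ε, and r_i(x) = ⟨a_i, x⟩ − b̃_i. Let 1 ≤ s ≤ ‖ε‖₀, so the s-th largest corruption magnitude ε_(s) is positive. Let (x_j)_{j∈ℕ} be an ℝⁿ-valued process adapted to a filtration (F_j) with E[‖x_0 − x⋆‖₂²] < ∞ and satisfying E[‖x_j − x⋆‖₂² | F_{j−1}] ≤ (1−ρ)‖x_{j−1} − x⋆‖₂² almost surely for all j ≥ 1, where ρ ∈ (0,1). Then for every η ∈ (0,1) there exists N₁ = N₁(η) such that with probability at least 1 − η, simultaneously for all j ≥ N₁: every set S ⊆ {1,…,m} of cardinality s with |r_i(x_j)| ≥ |r_{i'}(x_j)| for all i ∈ S and i' ∉ S satisfies ε_i ≠ 0 for every i ∈ S (the equations corresponding to the top s residuals are all corrupted). -/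
open MeasureTheory RealInnerProductSpace

/-- If `|ρ|` is larger on the support of `ε` than off it, then a set carrying the largest values of
`|ρ|` and no bigger than the support of `ε` lies in that support. -/
lemma ne_zero_of_mem_of_top_abs {ι : Type*} [Fintype ι] {ε ρ : ι → ℝ} {S : Finset ι}
    (hS : S.card ≤ (Finset.univ.filter fun i => ε i ≠ 0).card)
    (htop : ∀ i ∈ S, ∀ i' ∉ S, |ρ i'| ≤ |ρ i|)
    (hsep : ∀ i i', ε i = 0 → ε i' ≠ 0 → |ρ i| < |ρ i'|) :
    ∀ i ∈ S, ε i ≠ 0 := by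
  intro i hi h0
  have hsub : (Finset.univ.filter fun i => ε i ≠ 0) ⊆ S := by
    intro k hk
    by_contra hkS
    exact absurd (htop i hi k hkS) (not_le.2 (hsep i k h0 (Finset.mem_filter.1 hk).2))
  have hmem : i ∈ Finset.univ.filter fun i => ε i ≠ 0 :=
    (Finset.eq_of_subset_of_card_le hsub hS) ▸ hi
  exact (Finset.mem_filter.1 hmem).2 h0

/-- The nonzero values of a finite family are bounded away from zero. -/
lemma exists_pos_le_abs_of_ne_zero {ι : Type*} [Finite ι] (ε : ι → ℝ) :
    ∃ δ > 0, ∀ i, ε i ≠ 0 → δ ≤ |ε i| := by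
  have hev : ∀ᶠ δ in nhdsWithin (0 : ℝ) (Set.Ioi 0), ∀ i, ε i ≠ 0 → δ ≤ |ε i| := by
    refine Filter.eventually_all.2 fun i => ?_
    by_cases hi : ε i = 0
    · simp [hi]
    · filter_upwards [Ioo_mem_nhdsGT (abs_pos.2 hi)] with δ hδ _ using hδ.2.le
  obtain ⟨δ, hδ, hpos⟩ := (hev.and self_mem_nhdsWithin).exists
  exact ⟨δ, hpos, hδ⟩

/-- Conditional geometric contraction gives geometric decay of the expectations. -/
lemma integral_le_pow_mul_of_condExp_le {Ω : Type*} {m0 : MeasurableSpace Ω}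
    {μ : Measure Ω} [IsFiniteMeasure μ] {ℱ : Filtration ℕ m0} {d : ℕ → Ω → ℝ} {q : ℝ}
    (hq : 0 ≤ q) (hint : ∀ j, Integrable (d j) μ)
    (hcontr : ∀ j, μ[d (j + 1) | ℱ j] ≤ᵐ[μ] fun ω => q * d j ω) (j : ℕ) :
    ∫ ω, d j ω ∂μ ≤ q ^ j * ∫ ω, d 0 ω ∂μ := by
  induction j with
  | zero => simp
  | succ j ih =>
    calc ∫ ω, d (j + 1) ω ∂μ = ∫ ω, (μ[d (j + 1) | ℱ j]) ω ∂μ := (integral_condExp (ℱ.le j)).symm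
      _ ≤ ∫ ω, q * d j ω ∂μ :=
        integral_mono_ae integrable_condExp ((hint j).const_mul q) (hcontr j)
      _ = q * ∫ ω, d j ω ∂μ := integral_const_mul _ _
      _ ≤ q * (q ^ j * ∫ ω, d 0 ω ∂μ) := mul_le_mul_of_nonneg_left ih hq
      _ = q ^ (j + 1) * ∫ ω, d 0 ω ∂μ := by ring

/-- A nonnegative process with geometrically decaying expectations eventually stays below any
positive level, with probability arbitrarily close to one. -/
lemma exists_measure_iUnion_ge_le {Ω : Type*} {m0 : MeasurableSpace Ω}
    {μ : Measure Ω} [IsFiniteMeasure μ] {d : ℕ → Ω → ℝ} {q K c η : ℝ}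
    (hq0 : 0 ≤ q) (hq1 : q < 1) (hc : 0 < c) (hη : 0 < η)
    (hd : ∀ j ω, 0 ≤ d j ω) (hint : ∀ j, Integrable (d j) μ)
    (hdecay : ∀ j, ∫ ω, d j ω ∂μ ≤ q ^ j * K) :
    ∃ N : ℕ, μ (⋃ k, {ω | c ≤ d (k + N) ω}) ≤ ENNReal.ofReal η := by
  have hsum : Summable fun j : ℕ => q ^ j * K / c :=
    ((summable_geometric_of_lt_one hq0 hq1).mul_right K).div_const c
  have htail := ENNReal.tendsto_sum_nat_add (fun j => ENNReal.ofReal (q ^ j * K / c))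
    hsum.tsum_ofReal_ne_top
  obtain ⟨N, hN⟩ := (htail.eventually_le_const (ENNReal.ofReal_pos.2 hη)).exists
  refine ⟨N, (measure_iUnion_le _).trans ((ENNReal.tsum_le_tsum fun k => ?_).trans hN)⟩
  rw [← ofReal_measureReal]
  refine ENNReal.ofReal_le_ofReal ((le_div_iff₀' hc).2 ?_)
  exact (mul_meas_ge_le_integral_of_nonneg (Filter.Eventually.of_forall (hd _)) (hint _) c).trans
    (hdecay _)

/-- Residual-screening lemma, abstract form: unit-norm rows `a i`,
observed labels `b̃ i = ⟨a i, x⋆⟩ + ε i`, residuals `r i x = ⟨a i, x⟩ − b̃ i`, and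
`1 ≤ s ≤ ‖ε‖₀`.  If `(x j)` is an adapted `ℝⁿ`-valued process whose squared error
`‖x j − x⋆‖²` is integrable, with the conditional contraction
`E[‖x j − x⋆‖² | ℱ (j−1)] ≤ (1−ρ) ‖x (j−1) − x⋆‖²` a.s. for all `j ≥ 1`,
`ρ ∈ (0,1)`, then for every `η ∈ (0,1)` there is `N₁` such that with probability
at least `1 − η`, for all `j ≥ N₁` every size-`s` set carrying the `s` largest
residual magnitudes consists only of corrupted equations. -/
theorem residual_screening {m n : ℕ} {Ω : Type*} {m0 : MeasurableSpace Ω}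
    (μ : Measure Ω) [IsProbabilityMeasure μ] (ℱ : Filtration ℕ m0)
    (a : Fin m → EuclideanSpace ℝ (Fin n)) (ha : ∀ i, ‖a i‖ = 1)
    (xstar : EuclideanSpace ℝ (Fin n)) (ε : Fin m → ℝ)
    (btilde : Fin m → ℝ) (hb : ∀ i, btilde i = ⟪a i, xstar⟫ + ε i)
    (r : Fin m → EuclideanSpace ℝ (Fin n) → ℝ)
    (hr : ∀ i y, r i y = ⟪a i, y⟫ - btilde i)
    (s : ℕ) (hs1 : 1 ≤ s)
    (hs2 : s ≤ (Finset.univ.filter fun i => ε i ≠ 0).card)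
    (x : ℕ → Ω → EuclideanSpace ℝ (Fin n)) (hadapt : Adapted ℱ x)
    (hint : ∀ j, Integrable (fun ω => ‖x j ω - xstar‖ ^ 2) μ)
    (ρ : ℝ) (hρ : ρ ∈ Set.Ioo (0 : ℝ) 1)
    (hcontr : ∀ j : ℕ,
      μ[fun ω => ‖x (j + 1) ω - xstar‖ ^ 2 | ℱ j] ≤ᵐ[μ]
        fun ω => (1 - ρ) * ‖x j ω - xstar‖ ^ 2) :
    ∀ η ∈ Set.Ioo (0 : ℝ) 1, ∃ N₁ : ℕ,
      ENNReal.ofReal (1 - η) ≤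
        μ {ω | ∀ j ≥ N₁, ∀ S : Finset (Fin m), S.card = s →
          (∀ i ∈ S, ∀ i' ∉ S, |r i' (x j ω)| ≤ |r i (x j ω)|) →
          ∀ i ∈ S, ε i ≠ 0} := by
  rintro η ⟨hη, -⟩
  obtain ⟨δ, hδ, hδε⟩ := exists_pos_le_abs_of_ne_zero ε
  have hq0 : 0 ≤ 1 - ρ := by linarith [hρ.2]
  obtain ⟨N, hN⟩ := exists_measure_iUnion_ge_le (c := (δ / 2) ^ 2) hq0 (by linarith [hρ.1])
    (by positivity) hη (fun j ω => sq_nonneg ‖x j ω - xstar‖) hint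
    (integral_le_pow_mul_of_condExp_le hq0 hint hcontr)
  refine ⟨N, ?_⟩
  set B : Set Ω := ⋃ k, {ω | (δ / 2) ^ 2 ≤ ‖x (k + N) ω - xstar‖ ^ 2}
  have hBc : ENNReal.ofReal (1 - η) ≤ μ Bᶜ := by
    rw [ENNReal.ofReal_sub _ hη.le, ENNReal.ofReal_one, tsub_le_iff_left]
    calc (1 : ENNReal) = μ (B ∪ Bᶜ) := by rw [Set.union_compl_self, measure_univ]
      _ ≤ μ B + μ Bᶜ := measure_union_le _ _
      _ ≤ ENNReal.ofReal η + μ Bᶜ := by gcongr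
  refine hBc.trans (measure_mono fun ω hω j hj S hS htop => ?_)
  refine ne_zero_of_mem_of_top_abs (hS.trans_le hs2) htop fun i i' hi hi' => ?_
  have hclose : ‖x j ω - xstar‖ < δ / 2 := by
    by_contra! hge
    refine hω (Set.mem_iUnion.2 ⟨j - N, ?_⟩)
    rw [Set.mem_ofPred_eq, Nat.sub_add_cancel hj]
    gcongr
  have hinner (k : Fin m) : |⟪a k, x j ω - xstar⟫| < δ / 2 :=
    ((abs_real_inner_le_norm _ _).trans_eq (by rw [ha, one_mul])).trans_lt hclose
  have hres (k : Fin m) : r k (x j ω) = ⟪a k, x j ω - xstar⟫ - ε k := by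
    rw [hr, hb, inner_sub_right]; ring
  have htri := abs_sub_abs_le_abs_sub (ε i') ⟪a i', x j ω - xstar⟫
  rw [hres, hres, hi, sub_zero, abs_sub_comm _ (ε i')]
  linarith [hinner i, hinner i', hδε i' hi']
end
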